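/- For $a > 1$, $n \geq 1$, $0 \leq \alpha \leq \beta$ and admissible $x \geq 0$, the second central moment of $K_{n,a}^{\alpha,\beta}$ satisfies $K_{n,a}^{\alpha,\beta}((t-x)^2; x) \leq \frac{x}{n+\beta}\left(1 + \frac{1}{a-1}\right)$, and consequently $\lim_{n\to\infty} K_{n,a}^{\alpha,\beta}((t-x)^2; x) = 0$ for each fixed $x$. -/

import Mathlib

/-- Charlier polynomial `C_k^{(a)}(u) = ∑_{r=0}^k (k choose r) (-u)_r (1/a)^r`. -/
noncomputable def charlier (a u : ℝ) (k : ℕ) : ℝ :=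
  ∑ r ∈ Finset.range (k + 1),
    (k.choose r : ℝ) * (ascPochhammer ℝ r).eval (-u) * (1 / a) ^ r

/-- The radicand appearing in the definition of `rstar`. -/
noncomputable def radicand (a α β x : ℝ) (n : ℕ) : ℝ :=
  (4 + 2 * α + 1 / (a - 1)) ^ 2 + 4 * (((n : ℝ) + β) ^ 2 * x ^ 2 - 10 / 3 - 3 * α - α ^ 2)

/-- The function `r*_{n,a}(x; α, β)`. -/
noncomputable def rstar (a α β x : ℝ) (n : ℕ) : ℝ :=
  (-(4 + 2 * α + 1 / (a - 1)) + Real.sqrt (radicand a α β x n)) / (2 * n)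

/-- The Kantorovich-Charlier operator `K_{n,a}^{α,β}(f; x)`. -/
noncomputable def K (a α β : ℝ) (n : ℕ) (f : ℝ → ℝ) (x : ℝ) : ℝ :=
  ((n : ℝ) + β) * Real.exp (-1) * (1 - 1 / a) ^ ((a - 1) * n * rstar a α β x n) *
    ∑' k : ℕ, charlier a (-(a - 1) * n * rstar a α β x n) k / (Nat.factorial k : ℝ) *
      ∫ s in ((k + α) / ((n : ℝ) + β))..((k + α + 1) / ((n : ℝ) + β)), f s

lemma le_of_sq_le_sq_aux {a b : ℝ} (h : a ^ 2 ≤ b ^ 2) (hb : 0 ≤ b) : a ≤ b :=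
  abs_le_of_sq_le_sq' h hb |>.2

lemma hasSum_cauchy_aux {f g : ℕ → ℝ} {A B : ℝ} (hf : HasSum f A) (hg : HasSum g B) :
    HasSum (fun n => ∑ k ∈ Finset.range (n + 1), f k * g (n - k)) (A * B) := by
  have h := hasSum_sum_range_mul_of_summable_norm hf.summable.norm hg.summable.norm
  rwa [hf.tsum_eq, hg.tsum_eq] at h

lemma hasSum_shift_aux {f : ℕ → ℝ} {s : ℝ} (h0 : f 0 = 0)
    (h : HasSum (fun n => f (n + 1)) s) : HasSum f s := by
  have := (hasSum_nat_add_iff 1).1 h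
  simpa [h0] using this

/-- Poisson weights (unnormalised). -/
noncomputable def pw (j : ℕ) : ℝ := 1 / (Nat.factorial j : ℝ)

/-- Negative binomial weights (unnormalised). -/
noncomputable def qw (c b : ℝ) (r : ℕ) : ℝ :=
  (ascPochhammer ℝ r).eval b * c ^ r / (Nat.factorial r : ℝ)

lemma pw_zero_sum : HasSum pw (Real.exp 1) := by
  have h := NormedSpace.expSeries_div_hasSum_exp (𝔸 := ℝ) (1 : ℝ)
  rw [← Real.exp_eq_exp_ℝ] at h
  convert! h using 1
  funext j
  simp [pw]

lemma pw_succ (j : ℕ) : ((j + 1 : ℕ) : ℝ) * pw (j + 1) = pw j := by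
  have h : (Nat.factorial j : ℝ) ≠ 0 := by positivity
  have h' : (j : ℝ) + 1 ≠ 0 := by positivity
  simp only [pw, Nat.factorial_succ]
  push_cast
  field_simp

lemma pw_one_sum : HasSum (fun j : ℕ => (j : ℝ) * pw j) (Real.exp 1) := by
  apply hasSum_shift_aux (by simp)
  simp_rw [pw_succ]
  exact pw_zero_sum

lemma pw_two_sum : HasSum (fun j : ℕ => (j : ℝ) ^ 2 * pw j) (2 * Real.exp 1) := by
  apply hasSum_shift_aux (by simp)
  convert! pw_one_sum.add pw_zero_sum using 1
  · funext j
    rw [pow_two, mul_assoc, pw_succ]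
    push_cast
    ring
  · ring

lemma qw_zero_sum {c : ℝ} (hc0 : 0 ≤ c) (hc : c < 1) (b : ℝ) :
    HasSum (qw c b) (1 / (1 - c) ^ b) := by
  have h := (Real.one_div_one_sub_rpow_hasFPowerSeriesOnBall_zero b).hasSum (y := c) (by
    simp [enorm_eq_nnnorm, ← NNReal.coe_lt_coe, abs_of_nonneg hc0, hc])
  simp only [zero_add] at h
  convert! h using 1
  funext r
  have h2 := Ring.factorial_nsmul_multichoose_eq_ascPochhammer b r
  rw [Polynomial.ascPochhammer_smeval_cast, Polynomial.ascPochhammer_smeval_eq_eval,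
    Ring.multichoose_eq, nsmul_eq_mul] at h2
  have h3 : (Nat.factorial r : ℝ) ≠ 0 := by positivity
  simp [qw, ← h2]
  field_simp

lemma qw_succ (c b : ℝ) (r : ℕ) :
    ((r + 1 : ℕ) : ℝ) * qw c b (r + 1) = b * c * qw c (b + 1) r := by
  have h : (Nat.factorial r : ℝ) ≠ 0 := by positivity
  have h' : (r : ℝ) + 1 ≠ 0 := by positivity
  simp only [qw, Nat.factorial_succ, ascPochhammer_succ_left, Polynomial.eval_mul,
    Polynomial.eval_X, Polynomial.eval_comp, Polynomial.eval_add, Polynomial.eval_one]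
  push_cast
  field_simp
  ring

lemma qw_one_sum {c : ℝ} (hc0 : 0 ≤ c) (hc : c < 1) (b : ℝ) :
    HasSum (fun r : ℕ => (r : ℝ) * qw c b r) (b * c * (1 / (1 - c) ^ (b + 1))) := by
  apply hasSum_shift_aux (by simp)
  simp_rw [qw_succ]
  exact (qw_zero_sum hc0 hc (b + 1)).mul_left _

lemma qw_two_sum {c : ℝ} (hc0 : 0 ≤ c) (hc : c < 1) (b : ℝ) :
    HasSum (fun r : ℕ => (r : ℝ) ^ 2 * qw c b r)
      (b * c * ((b + 1) * c * (1 / (1 - c) ^ (b + 1 + 1)) + 1 / (1 - c) ^ (b + 1))) := by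
  apply hasSum_shift_aux (by simp)
  convert! ((qw_one_sum hc0 hc (b + 1)).add (qw_zero_sum hc0 hc (b + 1))).mul_left (b * c) using 1
  funext j
  rw [pow_two, mul_assoc, qw_succ]
  push_cast
  ring

lemma charlier_eq (a u : ℝ) (k : ℕ) :
    charlier a u k / (Nat.factorial k : ℝ) =
      ∑ r ∈ Finset.range (k + 1), qw (1 / a) (-u) r * pw (k - r) := by
  rw [charlier, Finset.sum_div]
  refine Finset.sum_congr rfl fun r hr => ?_
  have hr' : r ≤ k := by simpa [Nat.lt_succ_iff] using hr
  rw [Nat.cast_choose ℝ hr', qw, pw]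
  have h : (Nat.factorial r : ℝ) ≠ 0 := by positivity
  have h1 : (Nat.factorial k : ℝ) ≠ 0 := by positivity
  have h2 : (Nat.factorial (k - r) : ℝ) ≠ 0 := by positivity
  field_simp

lemma moments {a y : ℝ} (ha : 1 < a) (A B C : ℝ) :
    HasSum (fun k : ℕ => charlier a (-((a - 1) * y)) k / (Nat.factorial k : ℝ) *
        (A * (k : ℝ) ^ 2 + B * k + C))
      (Real.exp 1 * (1 / (1 - 1 / a) ^ ((a - 1) * y)) *
        (A * (y ^ 2 + y * (3 + 1 / (a - 1)) + 2) + B * (y + 1) + C)) := by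
  have ha0 : 0 < a := by linarith
  have ha1 : 0 < a - 1 := by linarith
  have hc0 : 0 ≤ 1 / a := by positivity
  have hc : 1 / a < 1 := by rw [div_lt_one ha0]; exact ha
  have hc1 : 0 < 1 - 1 / a := by linarith
  have q0 := qw_zero_sum hc0 hc ((a - 1) * y)
  have q1 := qw_one_sum hc0 hc ((a - 1) * y)
  have q2 := qw_two_sum hc0 hc ((a - 1) * y)
  rw [Real.rpow_add hc1 _ 1, Real.rpow_one] at q1
  rw [Real.rpow_add hc1 _ 1, Real.rpow_add hc1 _ 1, Real.rpow_one] at q2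
  have s0 := hasSum_cauchy_aux q0 pw_zero_sum
  have s1 := (hasSum_cauchy_aux q1 pw_zero_sum).add (hasSum_cauchy_aux q0 pw_one_sum)
  have s2 := ((hasSum_cauchy_aux q2 pw_zero_sum).add
    ((hasSum_cauchy_aux q1 pw_one_sum).mul_left 2)).add (hasSum_cauchy_aux q0 pw_two_sum)
  convert! ((s2.mul_left A).add (s1.mul_left B)).add (s0.mul_left C) using 1
  · funext k
    rw [charlier_eq, neg_neg, Finset.sum_mul]
    simp only [Finset.mul_sum, ← Finset.sum_add_distrib]
    refine Finset.sum_congr rfl fun r hr => ?_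
    have hr' : r ≤ k := by simpa [Nat.lt_succ_iff] using hr
    rw [Nat.cast_sub hr']
    ring
  · have hX : 0 < (1 - 1 / a) ^ ((a - 1) * y) := Real.rpow_pos_of_pos hc1 _
    have e : (1 - 1 / a) = (a - 1) / a := by field_simp
    generalize (1 - 1 / a) ^ ((a - 1) * y) = X at *
    rw [e]
    field_simp
    ring

lemma K_eq (a α β x : ℝ) (n : ℕ) (ha : 1 < a) (hn : 1 ≤ n) (hβ : 0 ≤ β) :
    K a α β n (fun t => (t - x) ^ 2) x =
      ((n * rstar a α β x n) ^ 2 + (n * rstar a α β x n) * (4 + 2 * α + 1 / (a - 1))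
        + α ^ 2 + 3 * α + 10 / 3) / ((n : ℝ) + β) ^ 2
      - 2 * x * ((n * rstar a α β x n) + α + 3 / 2) / ((n : ℝ) + β) + x ^ 2 := by
  have hN : 0 < (n : ℝ) + β := by
    have : (1 : ℝ) ≤ n := by exact_mod_cast hn
    linarith
  have ha0 : 0 < a := by linarith
  have ha1 : 0 < a - 1 := by linarith
  have hc1 : 0 < 1 - 1 / a := by
    have : 1 / a < 1 := by rw [div_lt_one ha0]; exact ha
    linarith
  unfold K
  generalize rstar a α β x n = R
  have e1 : -(a - 1) * n * R = -((a - 1) * (n * R)) := by ring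
  have e2 : (a - 1) * n * R = (a - 1) * (n * R) := by ring
  rw [e1, e2]
  generalize (n : ℝ) * R = y
  generalize (n : ℝ) + β = N at *
  have hint : ∀ k : ℕ, ∫ s in ((k + α) / N)..((k + α + 1) / N), (s - x) ^ 2 =
      1 / N ^ 3 * (k : ℝ) ^ 2 + (2 * (α - N * x) + 1) / N ^ 3 * k
        + ((α - N * x) ^ 2 + (α - N * x) + 1 / 3) / N ^ 3 := by
    intro k
    rw [intervalIntegral.integral_comp_sub_right (fun s => s ^ 2), integral_pow]
    push_cast
    field_simp
    ring
  simp_rw [hint]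
  rw [(moments ha _ _ _).tsum_eq]
  have hX : 0 < (1 - 1 / a) ^ ((a - 1) * y) := Real.rpow_pos_of_pos hc1 _
  generalize (1 - 1 / a) ^ ((a - 1) * y) = X at *
  have hE : Real.exp (-1) * Real.exp 1 = 1 := by rw [← Real.exp_add]; simp
  rw [show ∀ Z : ℝ, N * Real.exp (-1) * X * (Real.exp 1 * (1 / X) * Z) =
    (Real.exp (-1) * Real.exp 1) * (X * (1 / X)) * (N * Z) by intro Z; ring, hE,
    mul_one_div_cancel hX.ne']
  field_simp
  ring

lemma K_bounds (a α β x : ℝ) (n : ℕ) (ha : 1 < a) (hn : 1 ≤ n) (hα : 0 ≤ α) (hβ : 0 ≤ β)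
    (hx : 0 ≤ x) (h1 : 0 ≤ radicand a α β x n) (h2 : 0 ≤ rstar a α β x n) :
    0 ≤ K a α β n (fun t => (t - x) ^ 2) x ∧
    K a α β n (fun t => (t - x) ^ 2) x ≤ x / ((n : ℝ) + β) * (1 + 1 / (a - 1)) := by
  have hn1 : (1 : ℝ) ≤ n := by exact_mod_cast hn
  have hN : 0 < (n : ℝ) + β := by linarith
  have hd : 0 < 1 / (a - 1) := by
    have : 0 < a - 1 := by linarith
    positivity
  rw [K_eq a α β x n ha hn hβ]
  have hy : 0 ≤ (n : ℝ) * rstar a α β x n := by positivity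
  have hs : Real.sqrt (radicand a α β x n) =
      2 * ((n : ℝ) * rstar a α β x n) + (4 + 2 * α + 1 / (a - 1)) := by
    rw [rstar]; field_simp; ring
  have hsq := Real.sq_sqrt h1
  rw [hs, radicand] at hsq
  generalize (n : ℝ) * rstar a α β x n = y at *
  generalize 1 / (a - 1) = d at *
  generalize (n : ℝ) + β = N at *
  have hq : y ^ 2 + y * (4 + 2 * α + d) + α ^ 2 + 3 * α + 10 / 3 = N ^ 2 * x ^ 2 := by
    linarith
  rw [hq]
  have e : N ^ 2 * x ^ 2 / N ^ 2 - 2 * x * (y + α + 3 / 2) / N + x ^ 2 =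
      x / N * (2 * (N * x - (y + α + 3 / 2))) := by
    field_simp
    ring
  rw [e]
  have hxN : 0 ≤ x / N := by positivity
  have hNx : 0 ≤ N * x := by positivity
  refine ⟨mul_nonneg hxN ?_, mul_le_mul_of_nonneg_left ?_ hxN⟩
  · have : y + α + 3 / 2 ≤ N * x := by
      apply le_of_sq_le_sq_aux _ hNx
      nlinarith [mul_nonneg hy hd.le]
    linarith
  · have : 2 * (N * x) ≤ 2 * y + (4 + 2 * α + d) := by
      apply le_of_sq_le_sq_aux _ (by linarith)
      nlinarith [mul_nonneg hα hd.le, sq_nonneg d]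
    linarith

/-- Bound on the second central moment and its convergence to zero. -/
theorem K_second_central_moment_bound (a α β x : ℝ) (n : ℕ) (ha : 1 < a)
    (hn : 1 ≤ n) (hα : 0 ≤ α) (hαβ : α ≤ β) (hx : 0 ≤ x)
    (hadm : ∀ m : ℕ, 1 ≤ m → 0 ≤ radicand a α β x m ∧ 0 ≤ rstar a α β x m) :
    K a α β n (fun t => (t - x) ^ 2) x ≤ x / ((n : ℝ) + β) * (1 + 1 / (a - 1)) ∧
      Filter.Tendsto (fun m : ℕ => K a α β m (fun t => (t - x) ^ 2) x)
        Filter.atTop (nhds 0) := by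
  have hb : ∀ m : ℕ, 1 ≤ m → _ := fun m hm =>
    K_bounds a α β x m ha hm hα (hα.trans hαβ) hx (hadm m hm).1 (hadm m hm).2
  refine ⟨(hb n hn).2, ?_⟩
  have hlim : Filter.Tendsto (fun m : ℕ => x / ((m : ℝ) + β) * (1 + 1 / (a - 1)))
      Filter.atTop (nhds 0) := by
    have h := (Filter.Tendsto.const_div_atTop (Filter.tendsto_atTop_add_const_right _ β
      (tendsto_natCast_atTop_atTop (R := ℝ))) x).mul_const (1 + 1 / (a - 1))
    simpa using h
  refine tendsto_of_tendsto_of_tendsto_of_le_of_le' tendsto_const_nhds hlim ?_ ?_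
  · filter_upwards [Filter.eventually_ge_atTop 1] with m hm using (hb m hm).1
  · filter_upwards [Filter.eventually_ge_atTop 1] with m hm using (hb m hm).2
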